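/- Vanishing of the annealed term in the interpolation (Lemma E.1). For every t ∈ (0,1), the quantity B := (1/n) E ⟨ ∑_{μ=1}^n u′_{Y_{tμ}}(s_{tμ}) · (d s_{tμ}/dt) ⟩_t is identically zero, where u_y(x) = log P_out(y|x), u′_y = ∂_x u_y, E denotes expectation over all the quenched randomness (inputs, teacher parameters, noises and responses) and d s_{tμ}/dt is the t-derivative of s_{tμ}. -/

import Mathlib

open MeasureTheory ProbabilityTheory

noncomputable section

/-- Standard Gaussian measure on `ℝ`. -/
def stdG : Measure ℝ := gaussianReal 0 1

instance : IsProbabilityMeasure stdG := by unfold stdG; infer_instance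

/-- Standard Gaussian measure on `Fin k → ℝ`. -/
def stdGPi (k : ℕ) : Measure (Fin k → ℝ) := Measure.pi fun _ => stdG

instance (k : ℕ) : IsProbabilityMeasure (stdGPi k) := by unfold stdGPi; infer_instance

/-- The space of weights of an `L`-hidden-layer network with widths `d 0, …, d L`. -/
abbrev Wspace (d : ℕ → ℕ) (L : ℕ) :=
  (ℓ : Fin L) → Fin (d ((ℓ : ℕ) + 1)) → Fin (d (ℓ : ℕ)) → ℝ

/-- i.i.d. standard Gaussian measure on the weights. -/
def Wmeasure (d : ℕ → ℕ) (L : ℕ) : Measure (Wspace d L) :=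
  Measure.pi fun ℓ => Measure.pi fun _ => stdGPi (d (ℓ : ℕ))

instance (d : ℕ → ℕ) (L : ℕ) : IsProbabilityMeasure (Wmeasure d L) := by
  unfold Wmeasure; infer_instance

/-- Extension of a finite collection of weight matrices to all layer indices (by zero). -/
def extW {d : ℕ → ℕ} {L : ℕ} (W : Wspace d L) (ℓ : ℕ) : Fin (d (ℓ + 1)) → Fin (d ℓ) → ℝ :=
  if h : ℓ < L then W ⟨ℓ, h⟩ else 0

/-- Post-activations `X^{(ℓ)} = φ(W^{(ℓ)} X^{(ℓ-1)} / √d_{ℓ-1})`. -/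
def feat (φ : ℝ → ℝ) (d : ℕ → ℕ) (W : (ℓ : ℕ) → Fin (d (ℓ + 1)) → Fin (d ℓ) → ℝ)
    (x0 : Fin (d 0) → ℝ) : (ℓ : ℕ) → Fin (d ℓ) → ℝ
  | 0 => x0
  | (ℓ + 1) => fun i => φ ((∑ j, W ℓ i j * feat φ d W x0 ℓ j) / Real.sqrt (d ℓ : ℝ))

/-- Output kernel `P_out(y | x)`. -/
def Pout {p : ℕ} (PA : Measure (Fin p → ℝ)) (Δ : ℝ) (f : ℝ → (Fin p → ℝ) → ℝ)
    (y x : ℝ) : ℝ :=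
  ∫ A, Real.exp (-(y - f x A) ^ 2 / (2 * Δ)) / Real.sqrt (2 * Real.pi * Δ) ∂PA

/-- The channel smeared with the extra Gaussian noise `√ε ξ`. -/
def PoutEps {p : ℕ} (PA : Measure (Fin p → ℝ)) (Δ : ℝ) (f : ℝ → (Fin p → ℝ) → ℝ)
    (ε y s : ℝ) : ℝ :=
  ∫ ξ, Pout PA Δ f y (s + Real.sqrt ε * ξ) ∂stdG

/-- The coefficients `σ_ℓ`. -/
def sigmaC (φ : ℝ → ℝ) : ℕ → ℝ
  | 0 => 1
  | (ℓ + 1) => ∫ z, (φ (z * Real.sqrt (sigmaC φ ℓ))) ^ 2 ∂stdG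

/-- The coefficients `ρ_ℓ` (meaningful for `ℓ ≥ 1`). -/
def rhoC (φ : ℝ → ℝ) (ℓ : ℕ) : ℝ :=
  ∫ z, deriv φ (z * Real.sqrt (sigmaC φ (ℓ - 1))) ∂stdG

/-- The coefficients `ε_ℓ = σ_ℓ - σ_{ℓ-1} ρ_ℓ²` (meaningful for `ℓ ≥ 1`). -/
def epsC (φ : ℝ → ℝ) (ℓ : ℕ) : ℝ :=
  sigmaC φ ℓ - sigmaC φ (ℓ - 1) * (rhoC φ ℓ) ^ 2

/-- `d_m = min{d_0, …, d_L}`. -/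
def dmin (d : ℕ → ℕ) (L : ℕ) : ℕ :=
  (Finset.range (L + 1)).inf' (Finset.nonempty_range_iff.mpr (Nat.succ_ne_zero L)) d

/-- Linear readout of the `L`-layer network: `a⊤ X^{(L)} / √d_L`. -/
def netOut (φ : ℝ → ℝ) (d : ℕ → ℕ) (L : ℕ) (W : Wspace d L) (a : Fin (d L) → ℝ)
    (x0 : Fin (d 0) → ℝ) : ℝ :=
  (∑ i, a i * feat φ d (extW W) x0 L i) / Real.sqrt (d L : ℝ)

/-- Partition function (normalisation of the Bayes posterior) of the `L`-layer model. -/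
def partFun (L p : ℕ) (PA : Measure (Fin p → ℝ)) [IsProbabilityMeasure PA]
    (Δ ρ ε : ℝ) (φ : ℝ → ℝ) (f : ℝ → (Fin p → ℝ) → ℝ) (d : ℕ → ℕ) (n : ℕ)
    (X : Fin n → Fin (d 0) → ℝ) (Y : Fin n → ℝ) : ℝ :=
  ∫ θ : Wspace d L × (Fin (d L) → ℝ),
      ∏ μ, PoutEps PA Δ f ε (Y μ) (ρ * netOut φ d L θ.1 θ.2 (X μ))
    ∂((Wmeasure d L).prod (stdGPi (d L)))

/-- Space of all the quenched randomness of the `L`-layer teacher model: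
inputs, teacher weights, readout, output noises `ξ*`, label noises `Z` and channel
randomness `A`. -/
abbrev Dspace (d : ℕ → ℕ) (L p n : ℕ) :=
  (Fin n → Fin (d 0) → ℝ) × Wspace d L × (Fin (d L) → ℝ) ×
    (Fin n → ℝ) × (Fin n → ℝ) × (Fin n → Fin p → ℝ)

/-- Law of the quenched randomness. -/
def Dmeasure (d : ℕ → ℕ) (L p n : ℕ) (PA : Measure (Fin p → ℝ))
    [IsProbabilityMeasure PA] : Measure (Dspace d L p n) :=
  (Measure.pi fun _ : Fin n => stdGPi (d 0)).prod
    ((Wmeasure d L).prod ((stdGPi (d L)).prod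
      ((stdGPi n).prod ((stdGPi n).prod (Measure.pi fun _ : Fin n => PA)))))

/-- Teacher pre-readout signal `S_μ = ρ a*⊤X_μ^{(L)}/√d_L + √ε ξ*_μ`. -/
def Ssig (φ : ℝ → ℝ) (d : ℕ → ℕ) (L p n : ℕ) (ρ ε : ℝ) (ω : Dspace d L p n)
    (μi : Fin n) : ℝ :=
  ρ * netOut φ d L ω.2.1 ω.2.2.1 (ω.1 μi) + Real.sqrt ε * ω.2.2.2.1 μi

/-- Teacher responses `Y_μ = f(S_μ; A_μ) + √Δ Z_μ`. -/
def Yresp (φ : ℝ → ℝ) (f : ℝ → (Fin p → ℝ) → ℝ) (d : ℕ → ℕ) (L n : ℕ)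
    (ρ ε Δ : ℝ) (ω : Dspace d L p n) (μi : Fin n) : ℝ :=
  f (Ssig φ d L p n ρ ε ω μi) (ω.2.2.2.2.2 μi) + Real.sqrt Δ * ω.2.2.2.2.1 μi

/-- Mutual information per sample
`(1/n) I_n = E log P_out(Y_1|S_1) - (1/n) E log Z_L(D_L)`
(the first term is written as an average over samples, all equal by symmetry). -/
def MIper (L p : ℕ) (PA : Measure (Fin p → ℝ)) [IsProbabilityMeasure PA]
    (Δ ρ ε : ℝ) (φ : ℝ → ℝ) (f : ℝ → (Fin p → ℝ) → ℝ) (d : ℕ → ℕ) (n : ℕ) : ℝ :=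
  (1 / (n : ℝ)) * ∑ μi : Fin n,
      ∫ ω, Real.log (Pout PA Δ f (Yresp φ f d L n ρ ε Δ ω μi) (Ssig φ d L p n ρ ε ω μi))
        ∂(Dmeasure d L p n PA)
    - (1 / (n : ℝ)) *
      ∫ ω, Real.log (partFun L p PA Δ ρ ε φ f d n ω.1 (Yresp φ f d L n ρ ε Δ ω))
        ∂(Dmeasure d L p n PA)


/-- `u′_y(x) = ∂_x log P_out(y|x)`. -/
def uD1 {p : ℕ} (PA : Measure (Fin p → ℝ)) (Δ : ℝ) (f : ℝ → (Fin p → ℝ) → ℝ)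
    (y x : ℝ) : ℝ := deriv (fun x' => Real.log (Pout PA Δ f y x')) x

/-- First block of quenched randomness `ψ₁ = (X, ζ*, Z)`. -/
abbrev psi1Space (d : ℕ → ℕ) (n : ℕ) :=
  (Fin n → Fin (d 0) → ℝ) × (Fin n → ℝ) × (Fin n → ℝ)

def psi1Measure (d : ℕ → ℕ) (n : ℕ) : Measure (psi1Space d n) :=
  (Measure.pi fun _ : Fin n => stdGPi (d 0)).prod ((stdGPi n).prod (stdGPi n))

instance (d : ℕ → ℕ) (n : ℕ) : IsProbabilityMeasure (psi1Measure d n) := by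
  unfold psi1Measure; infer_instance

/-- Second block `ψ₂ = (A_μ)_μ`. -/
abbrev psi2Space (p n : ℕ) := Fin n → Fin p → ℝ

def psi2Measure (p n : ℕ) (PA : Measure (Fin p → ℝ)) [IsProbabilityMeasure PA] :
    Measure (psi2Space p n) := Measure.pi fun _ : Fin n => PA

instance (p n : ℕ) (PA : Measure (Fin p → ℝ)) [IsProbabilityMeasure PA] :
    IsProbabilityMeasure (psi2Measure p n PA) := by unfold psi2Measure; infer_instance

/-- Third block `ψ₃ = (W*, a*, v*)`. -/
abbrev psi3Space (d : ℕ → ℕ) (L : ℕ) :=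
  Wspace d L × (Fin (d L) → ℝ) × (Fin (d (L - 1)) → ℝ)

def psi3Measure (d : ℕ → ℕ) (L : ℕ) : Measure (psi3Space d L) :=
  (Wmeasure d L).prod ((stdGPi (d L)).prod (stdGPi (d (L - 1))))

instance (d : ℕ → ℕ) (L : ℕ) : IsProbabilityMeasure (psi3Measure d L) := by
  unfold psi3Measure; infer_instance

/-- Full quenched randomness of the interpolating model. -/
abbrev interpSpace (d : ℕ → ℕ) (L p n : ℕ) :=
  psi1Space d n × psi2Space p n × psi3Space d L

def interpMeasure (d : ℕ → ℕ) (L p n : ℕ) (PA : Measure (Fin p → ℝ))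
    [IsProbabilityMeasure PA] : Measure (interpSpace d L p n) :=
  (psi1Measure d n).prod ((psi2Measure p n PA).prod (psi3Measure d L))

/-- Interpolating signal
`√(1−t) a⊤φ(W^{(L)}X^{(L−1)}/√d_{L−1})/√d_L + √t ρ_L v⊤X^{(L−1)}/√d_{L−1} + √(tε_L) ζ`. -/
def interpSig (φ : ℝ → ℝ) (d : ℕ → ℕ) (L : ℕ) (t : ℝ) (W : Wspace d L)
    (a : Fin (d L) → ℝ) (v : Fin (d (L - 1)) → ℝ) (ζ : ℝ) (x0 : Fin (d 0) → ℝ) : ℝ :=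
  Real.sqrt (1 - t) * netOut φ d L W a x0 +
    Real.sqrt t * rhoC φ L *
      ((∑ j, v j * feat φ d (extW W) x0 (L - 1) j) / Real.sqrt (d (L - 1) : ℝ)) +
    Real.sqrt (t * epsC φ L) * ζ

/-- Teacher interpolating signal `S_{tμ}`. -/
def StI (φ : ℝ → ℝ) (d : ℕ → ℕ) (L p n : ℕ) (t : ℝ) (ω : interpSpace d L p n)
    (μi : Fin n) : ℝ :=
  interpSig φ d L t ω.2.2.1 ω.2.2.2.1 ω.2.2.2.2 (ω.1.2.1 μi) (ω.1.1 μi)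

/-- Interpolating responses `Y_{tμ} = f(S_{tμ};A_μ) + √Δ Z_μ`. -/
def YtI (φ : ℝ → ℝ) (f : ℝ → (Fin p → ℝ) → ℝ) (d : ℕ → ℕ) (L n : ℕ) (Δ t : ℝ)
    (ω : interpSpace d L p n) (μi : Fin n) : ℝ :=
  f (StI φ d L p n t ω μi) (ω.2.1 μi) + Real.sqrt Δ * ω.1.2.2 μi

/-- Student variables `(W, a, v, ζ)` of the interpolating model. -/
abbrev studSpace (d : ℕ → ℕ) (L n : ℕ) :=
  Wspace d L × (Fin (d L) → ℝ) × (Fin (d (L - 1)) → ℝ) × (Fin n → ℝ)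

def studMeasure (d : ℕ → ℕ) (L n : ℕ) : Measure (studSpace d L n) :=
  (Wmeasure d L).prod ((stdGPi (d L)).prod ((stdGPi (d (L - 1))).prod (stdGPi n)))

instance (d : ℕ → ℕ) (L n : ℕ) : IsProbabilityMeasure (studMeasure d L n) := by
  unfold studMeasure; infer_instance

/-- Student replica `s_{tμ}`. -/
def stI (φ : ℝ → ℝ) (d : ℕ → ℕ) (L n : ℕ) (t : ℝ) (X : Fin n → Fin (d 0) → ℝ)
    (τ : studSpace d L n) (μi : Fin n) : ℝ :=
  interpSig φ d L t τ.1 τ.2.1 τ.2.2.1 (τ.2.2.2 μi) (X μi)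

/-- Interpolating partition function `Z_t`. -/
def ZtI (L p : ℕ) (PA : Measure (Fin p → ℝ)) [IsProbabilityMeasure PA] (Δ : ℝ)
    (φ : ℝ → ℝ) (f : ℝ → (Fin p → ℝ) → ℝ) (d : ℕ → ℕ) (n : ℕ) (t : ℝ)
    (ω : interpSpace d L p n) : ℝ :=
  ∫ τ, ∏ μi, Pout PA Δ f (YtI φ f d L n Δ t ω μi) (stI φ d L n t ω.1.1 τ μi)
    ∂(studMeasure d L n)

/-- The centred Gaussian density of variance `Δ`. -/
def noiseDensity (Δ u : ℝ) : ℝ := Real.exp (-u ^ 2 / (2 * Δ)) / Real.sqrt (2 * Real.pi * Δ)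

section Channel

variable {p : ℕ} {PA : Measure (Fin p → ℝ)} {Δ : ℝ}
  {f : ℝ → (Fin p → ℝ) → ℝ}

lemma Pout_eq (y x : ℝ) : Pout PA Δ f y x = ∫ A, noiseDensity Δ (y - f x A) ∂PA := rfl

variable [IsProbabilityMeasure PA]

lemma noiseDensity_pos (hΔ : 0 < Δ) (u : ℝ) : 0 < noiseDensity Δ u := by
  unfold noiseDensity; positivity

lemma measurable_noiseDensity (Δ : ℝ) : Measurable (noiseDensity Δ) := by
  unfold noiseDensity; fun_prop

lemma noiseDensity_eq_gaussianPDFReal (hΔ : 0 < Δ) (m y : ℝ) :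
    noiseDensity Δ (y - m) = gaussianPDFReal m Δ.toNNReal y := by
  simp [noiseDensity, gaussianPDFReal, hΔ.le, div_eq_inv_mul]

lemma noiseDensity_le (hΔ : 0 < Δ) (u : ℝ) :
    noiseDensity Δ u ≤ (Real.sqrt (2 * Real.pi * Δ))⁻¹ := by
  rw [noiseDensity, div_eq_mul_inv]
  refine mul_le_of_le_one_left (by positivity) (Real.exp_le_one_iff.2 ?_)
  rw [neg_div]
  have : 0 ≤ u ^ 2 / (2 * Δ) := by positivity
  linarith

lemma abs_mul_noiseDensity_le (hΔ : 0 < Δ) (u : ℝ) :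
    |u| * noiseDensity Δ u ≤ (1 + 2 * Δ) * (Real.sqrt (2 * Real.pi * Δ))⁻¹ := by
  rw [noiseDensity, div_eq_mul_inv, ← mul_assoc]
  refine mul_le_mul_of_nonneg_right ?_ (by positivity)
  rw [neg_div, Real.exp_neg, ← div_eq_mul_inv, div_le_iff₀ (Real.exp_pos _)]
  have h1 := Real.add_one_le_exp (u ^ 2 / (2 * Δ))
  have h2 : |u| ≤ (1 + 2 * Δ) * (u ^ 2 / (2 * Δ) + 1) := by
    have h3 : (1 + 2 * Δ) * (u ^ 2 / (2 * Δ) + 1) = u ^ 2 / (2 * Δ) + u ^ 2 + 1 + 2 * Δ := by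
      field_simp; ring
    have h4 : 0 ≤ u ^ 2 / (2 * Δ) := by positivity
    rw [h3]
    nlinarith [sq_abs u, sq_nonneg (|u| - 1)]
  nlinarith

lemma integrable_mul_noiseDensity (hΔ : 0 < Δ) : Integrable fun u => u * noiseDensity Δ u := by
  have h := (integrable_mul_exp_neg_mul_sq (b := (2 * Δ)⁻¹) (by positivity)).mul_const
    (Real.sqrt (2 * Real.pi * Δ))⁻¹
  refine h.congr (Filter.Eventually.of_forall fun u => ?_)
  simp only [noiseDensity]
  rw [show -u ^ 2 / (2 * Δ) = -(2 * Δ)⁻¹ * u ^ 2 by ring]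
  ring

lemma integral_mul_noiseDensity (Δ : ℝ) : ∫ u, u * noiseDensity Δ u = 0 := by
  have h := integral_neg_eq_self (fun u => u * noiseDensity Δ u) volume
  have h2 : ∀ u, -u * noiseDensity Δ (-u) = -(u * noiseDensity Δ u) := fun u => by
    simp [noiseDensity]
  simp_rw [h2, integral_neg] at h
  linarith

lemma hasDerivAt_noiseDensity (Δ u : ℝ) :
    HasDerivAt (noiseDensity Δ) (-(u / Δ) * noiseDensity Δ u) u := by
  have h := ((((hasDerivAt_id u).pow 2).neg.div_const (2 * Δ)).exp).div_const
    (Real.sqrt (2 * Real.pi * Δ))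
  refine h.congr_deriv ?_
  simp [noiseDensity]
  ring

/-- Regularity of the channel function that is used throughout. -/
structure ChannelRegular (f : ℝ → (Fin p → ℝ) → ℝ) (K : ℝ) : Prop where
  measurable : Measurable (Function.uncurry f)
  differentiable : ∀ A, Differentiable ℝ fun x => f x A
  bound : ∀ x A, |deriv (fun x' => f x' A) x| ≤ K

/-- The `x`-derivative of the integrand in `Pout`. -/
def noiseDeriv (Δ : ℝ) (f : ℝ → (Fin p → ℝ) → ℝ) (y x : ℝ) (A : Fin p → ℝ) : ℝ :=
  (deriv (fun x' => f x' A) x / Δ) * ((y - f x A) * noiseDensity Δ (y - f x A))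

/-- The derivative `∂ₓ P_out(y|x)`. -/
def dPout (PA : Measure (Fin p → ℝ)) (Δ : ℝ) (f : ℝ → (Fin p → ℝ) → ℝ) (y x : ℝ) : ℝ :=
  ∫ A, noiseDeriv Δ f y x A ∂PA

lemma ChannelRegular.measurable_comp {K : ℝ} (hf : ChannelRegular f K) {α : Type*}
    [MeasurableSpace α] {g : α → ℝ} {a : α → Fin p → ℝ} (hg : Measurable g) (ha : Measurable a) :
    Measurable fun z => f (g z) (a z) :=
  hf.measurable.comp (hg.prodMk ha)

lemma ChannelRegular.measurable_deriv {K : ℝ} (hf : ChannelRegular f K) :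
    Measurable fun q : ℝ × (Fin p → ℝ) => deriv (fun x' => f x' q.2) q.1 := by
  refine measurable_of_tendsto_metrizable (f := fun (k : ℕ) (q : ℝ × (Fin p → ℝ)) =>
    (1 / ((k : ℝ) + 1))⁻¹ * (f (q.1 + 1 / ((k : ℝ) + 1)) q.2 - f q.1 q.2)) (fun k => ?_) ?_
  · have h1 : Measurable fun q : ℝ × (Fin p → ℝ) => f (q.1 + 1 / ((k : ℝ) + 1)) q.2 :=
      hf.measurable_comp (by fun_prop) (by fun_prop)
    have h2 : Measurable fun q : ℝ × (Fin p → ℝ) => f q.1 q.2 := hf.measurable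
    fun_prop
  · rw [tendsto_pi_nhds]
    rintro ⟨x, A⟩
    have h := (hf.differentiable A x).hasDerivAt.tendsto_slope_zero_right
    refine h.comp (tendsto_nhdsWithin_iff.2
      ⟨tendsto_one_div_add_atTop_nhds_zero_nat, Filter.Eventually.of_forall fun k => ?_⟩)
    simp only [Set.mem_Ioi]
    positivity

lemma ChannelRegular.measurable_noiseDeriv {K : ℝ} (hf : ChannelRegular f K) :
    Measurable fun q : (ℝ × ℝ) × (Fin p → ℝ) => noiseDeriv Δ f q.1.1 q.1.2 q.2 := by
  have h1 : Measurable fun q : (ℝ × ℝ) × (Fin p → ℝ) => f q.1.2 q.2 :=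
    hf.measurable_comp (by fun_prop) (by fun_prop)
  have h2 : Measurable fun q : (ℝ × ℝ) × (Fin p → ℝ) => deriv (fun x' => f x' q.2) q.1.2 :=
    hf.measurable_deriv.comp (f := fun q : (ℝ × ℝ) × (Fin p → ℝ) => (q.1.2, q.2)) (by fun_prop)
  have h3 := measurable_noiseDensity Δ
  have h4 : Measurable fun q : (ℝ × ℝ) × (Fin p → ℝ) => q.1.1 - f q.1.2 q.2 :=
    (measurable_fst.comp measurable_fst).sub h1
  exact (h2.div_const Δ).mul (h4.mul (h3.comp h4))

lemma ChannelRegular.measurable_dPout {K : ℝ} (hf : ChannelRegular f K) :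
    Measurable fun q : ℝ × ℝ => dPout PA Δ f q.1 q.2 :=
  (hf.measurable_noiseDeriv.stronglyMeasurable.integral_prod_right').measurable

lemma ChannelRegular.measurable_noise {K : ℝ} (hf : ChannelRegular f K) :
    Measurable fun q : (ℝ × ℝ) × (Fin p → ℝ) => noiseDensity Δ (q.1.1 - f q.1.2 q.2) := by
  have h1 : Measurable fun q : (ℝ × ℝ) × (Fin p → ℝ) => f q.1.2 q.2 :=
    hf.measurable_comp (by fun_prop) (by fun_prop)
  exact (measurable_noiseDensity Δ).comp ((measurable_fst.comp measurable_fst).sub h1)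

lemma ChannelRegular.measurable_Pout {K : ℝ} (hf : ChannelRegular f K) :
    Measurable fun q : ℝ × ℝ => Pout PA Δ f q.1 q.2 :=
  (hf.measurable_noise.stronglyMeasurable.integral_prod_right').measurable

lemma ChannelRegular.integrable_noise {K : ℝ} (hf : ChannelRegular f K) (hΔ : 0 < Δ) (y x : ℝ) :
    Integrable (fun A => noiseDensity Δ (y - f x A)) PA := by
  refine Integrable.of_bound (C := (Real.sqrt (2 * Real.pi * Δ))⁻¹) ?_
    (Filter.Eventually.of_forall fun A => ?_)
  · exact (hf.measurable_noise.comp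
      (f := fun A : Fin p → ℝ => ((y, x), A)) (by fun_prop)).aestronglyMeasurable
  · rw [Real.norm_of_nonneg (noiseDensity_pos hΔ _).le]
    exact noiseDensity_le hΔ _

lemma ChannelRegular.Pout_pos {K : ℝ} (hf : ChannelRegular f K) (hΔ : 0 < Δ) (y x : ℝ) :
    0 < Pout PA Δ f y x := by
  rw [Pout_eq, integral_pos_iff_support_of_nonneg (fun A => (noiseDensity_pos hΔ _).le)
    (hf.integrable_noise hΔ y x)]
  rw [show Function.support (fun A => noiseDensity Δ (y - f x A)) = Set.univ from
    Set.eq_univ_of_forall fun A => (noiseDensity_pos hΔ _).ne']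
  simp

lemma ChannelRegular.Pout_le {K : ℝ} (hf : ChannelRegular f K) (hΔ : 0 < Δ) (y x : ℝ) :
    Pout PA Δ f y x ≤ (Real.sqrt (2 * Real.pi * Δ))⁻¹ := by
  rw [Pout_eq]
  calc _ ≤ ∫ _A, (Real.sqrt (2 * Real.pi * Δ))⁻¹ ∂PA :=
        integral_mono (hf.integrable_noise hΔ y x) (integrable_const _)
          fun A => noiseDensity_le hΔ _
    _ = _ := by simp

lemma ChannelRegular.hasDerivAt_Pout {K : ℝ} (hf : ChannelRegular f K) (hΔ : 0 < Δ) (y x : ℝ) :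
    HasDerivAt (fun x' => Pout PA Δ f y x') (dPout PA Δ f y x) x := by
  refine (hasDerivAt_integral_of_dominated_loc_of_deriv_le (s := Set.univ)
    (F := fun x' A => noiseDensity Δ (y - f x' A)) (F' := fun x' A => noiseDeriv Δ f y x' A)
    (bound := fun _ => K / Δ * ((1 + 2 * Δ) * (Real.sqrt (2 * Real.pi * Δ))⁻¹))
    Filter.univ_mem (Filter.Eventually.of_forall fun x' =>
      (hf.integrable_noise hΔ y x').aestronglyMeasurable) (hf.integrable_noise hΔ y x) ?_ ?_
    (integrable_const _) ?_).2
  · exact (hf.measurable_noiseDeriv.comp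
      (f := fun A : Fin p → ℝ => ((y, x), A)) (by fun_prop)).aestronglyMeasurable
  · refine Filter.Eventually.of_forall fun A x' _ => ?_
    rw [noiseDeriv, norm_mul, norm_mul, norm_div, Real.norm_eq_abs, Real.norm_eq_abs,
      Real.norm_eq_abs, Real.norm_eq_abs, abs_of_pos hΔ, abs_of_pos (noiseDensity_pos hΔ _)]
    have hK : 0 ≤ K := (abs_nonneg _).trans (hf.bound x' A)
    refine mul_le_mul ?_ (abs_mul_noiseDensity_le hΔ _)
      (mul_nonneg (abs_nonneg _) (noiseDensity_pos hΔ _).le) (by positivity)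
    gcongr
    exact hf.bound x' A
  · refine Filter.Eventually.of_forall fun A x' _ => ?_
    have h := (hasDerivAt_noiseDensity Δ (y - f x' A)).comp x'
      ((hf.differentiable A x').hasDerivAt.const_sub y)
    refine h.congr_deriv ?_
    rw [noiseDeriv]
    ring

lemma ChannelRegular.uD1_eq {K : ℝ} (hf : ChannelRegular f K) (hΔ : 0 < Δ) (y x : ℝ) :
    uD1 PA Δ f y x = dPout PA Δ f y x / Pout PA Δ f y x :=
  ((hf.hasDerivAt_Pout hΔ y x).log (hf.Pout_pos hΔ y x).ne').deriv

lemma ChannelRegular.uD1_mul_Pout {K : ℝ} (hf : ChannelRegular f K) (hΔ : 0 < Δ) (y x : ℝ) :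
    uD1 PA Δ f y x * Pout PA Δ f y x = dPout PA Δ f y x := by
  rw [hf.uD1_eq hΔ, div_mul_cancel₀ _ (hf.Pout_pos hΔ y x).ne']

lemma integrable_noiseDeriv_left (hΔ : 0 < Δ) (x : ℝ) (A : Fin p → ℝ) :
    Integrable fun y => noiseDeriv Δ f y x A :=
  ((integrable_mul_noiseDensity hΔ).comp_sub_right (f x A)).const_mul _

lemma integral_noiseDeriv_left (x : ℝ) (A : Fin p → ℝ) : ∫ y, noiseDeriv Δ f y x A = 0 := by
  simp only [noiseDeriv]
  rw [integral_const_mul, integral_sub_right_eq_self (fun u => u * noiseDensity Δ u) (f x A),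
    integral_mul_noiseDensity, mul_zero]

lemma integral_norm_noiseDeriv_left (x : ℝ) (A : Fin p → ℝ) :
    ∫ y, ‖noiseDeriv Δ f y x A‖ =
      ‖deriv (fun x' => f x' A) x / Δ‖ * ∫ u, ‖u * noiseDensity Δ u‖ := by
  simp only [noiseDeriv]
  simp_rw [norm_mul (deriv _ _ / Δ)]
  rw [integral_const_mul,
    integral_sub_right_eq_self (fun u => ‖u * noiseDensity Δ u‖) (f x A)]

/-- A bound for the `L¹` norm of `y ↦ ∂ₓ P_out(y|x)`, uniform in `x`. -/
def dPoutBound (Δ K : ℝ) : ℝ := K / Δ * ∫ u, ‖u * noiseDensity Δ u‖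

lemma ChannelRegular.integral_norm_noiseDeriv_le {K : ℝ} (hf : ChannelRegular f K) (hΔ : 0 < Δ)
    (x : ℝ) (A : Fin p → ℝ) : ∫ y, ‖noiseDeriv Δ f y x A‖ ≤ dPoutBound Δ K := by
  rw [integral_norm_noiseDeriv_left, dPoutBound, norm_div, Real.norm_of_nonneg hΔ.le]
  refine mul_le_mul_of_nonneg_right ?_ (integral_nonneg fun _ => norm_nonneg _)
  gcongr
  exact hf.bound x A

lemma ChannelRegular.integrable_noiseDeriv {K : ℝ} (hf : ChannelRegular f K) (hΔ : 0 < Δ)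
    (x : ℝ) : Integrable (fun q : (Fin p → ℝ) × ℝ => noiseDeriv Δ f q.2 x q.1)
      (PA.prod volume) := by
  have hm : Measurable fun q : (Fin p → ℝ) × ℝ => noiseDeriv Δ f q.2 x q.1 :=
    hf.measurable_noiseDeriv.comp
      (f := fun q : (Fin p → ℝ) × ℝ => ((q.2, x), q.1)) (by fun_prop)
  rw [integrable_prod_iff hm.aestronglyMeasurable]
  refine ⟨Filter.Eventually.of_forall fun A => integrable_noiseDeriv_left hΔ x A, ?_⟩
  refine Integrable.of_bound (C := dPoutBound Δ K) ?_ (Filter.Eventually.of_forall fun A => ?_)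
  · exact hm.stronglyMeasurable.norm.integral_prod_right'.aestronglyMeasurable
  · rw [Real.norm_of_nonneg (integral_nonneg fun _ => norm_nonneg _)]
    exact hf.integral_norm_noiseDeriv_le hΔ x A

lemma ChannelRegular.integrable_dPout {K : ℝ} (hf : ChannelRegular f K) (hΔ : 0 < Δ) (x : ℝ) :
    Integrable fun y => dPout PA Δ f y x :=
  (hf.integrable_noiseDeriv hΔ x).integral_prod_right

lemma ChannelRegular.integral_dPout {K : ℝ} (hf : ChannelRegular f K) (hΔ : 0 < Δ) (x : ℝ) :
    ∫ y, dPout PA Δ f y x = 0 := by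
  simp only [dPout]
  have h := integral_integral_swap (f := fun (A : Fin p → ℝ) (y : ℝ) => noiseDeriv Δ f y x A)
    (hf.integrable_noiseDeriv (PA := PA) hΔ x)
  rw [← h]
  simp_rw [integral_noiseDeriv_left, integral_zero]

lemma ChannelRegular.integral_norm_dPout_le {K : ℝ} (hf : ChannelRegular f K) (hΔ : 0 < Δ)
    (x : ℝ) : ∫ y, ‖dPout PA Δ f y x‖ ≤ dPoutBound Δ K := by
  have hi := hf.integrable_noiseDeriv (PA := PA) hΔ x
  calc ∫ y, ‖dPout PA Δ f y x‖ ≤ ∫ y : ℝ, ∫ A, ‖noiseDeriv Δ f y x A‖ ∂PA :=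
        integral_mono (hf.integrable_dPout hΔ x).norm
          (Integrable.integral_prod_right
            (f := fun q : (Fin p → ℝ) × ℝ => ‖noiseDeriv Δ f q.2 x q.1‖) hi.norm) fun y => norm_integral_le_integral_norm _
    _ = ∫ A, (∫ y, ‖noiseDeriv Δ f y x A‖) ∂PA :=
        (integral_integral_swap (f := fun (A : Fin p → ℝ) (y : ℝ) => ‖noiseDeriv Δ f y x A‖)
          hi.norm).symm
    _ ≤ ∫ _A, dPoutBound Δ K ∂PA :=
        integral_mono
          (Integrable.integral_prod_left
            (f := fun q : (Fin p → ℝ) × ℝ => ‖noiseDeriv Δ f q.2 x q.1‖) hi.norm) (integrable_const _)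
          fun A => hf.integral_norm_noiseDeriv_le hΔ x A
    _ = dPoutBound Δ K := by simp

lemma ChannelRegular.lintegral_Pout {K : ℝ} (hf : ChannelRegular f K) (hΔ : 0 < Δ) (x : ℝ) :
    ∫⁻ y, ENNReal.ofReal (Pout PA Δ f y x) = 1 := by
  have hm : Measurable fun q : ℝ × (Fin p → ℝ) => ENNReal.ofReal (noiseDensity Δ (q.1 - f x q.2)) :=
    (hf.measurable_noise.comp
      (f := fun q : ℝ × (Fin p → ℝ) => ((q.1, x), q.2)) (by fun_prop)).ennreal_ofReal
  simp_rw [Pout_eq, fun y => ofReal_integral_eq_lintegral_ofReal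
    (hf.integrable_noise (PA := PA) hΔ y x)
    (Filter.Eventually.of_forall fun A => (noiseDensity_pos hΔ _).le)]
  rw [lintegral_lintegral_swap hm.aemeasurable]
  simp_rw [noiseDensity_eq_gaussianPDFReal hΔ,
    fun m => lintegral_gaussianPDFReal_eq_one m (Real.toNNReal_pos.2 hΔ).ne']
  simp

lemma ChannelRegular.integrable_Pout {K : ℝ} (hf : ChannelRegular f K) (hΔ : 0 < Δ) (x : ℝ) :
    Integrable fun y => Pout PA Δ f y x := by
  refine ⟨(hf.measurable_Pout.comp
    (f := fun y : ℝ => (y, x)) (by fun_prop)).aestronglyMeasurable, ?_⟩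
  rw [hasFiniteIntegral_iff_ofReal (Filter.Eventually.of_forall fun y => (hf.Pout_pos hΔ y x).le),
    hf.lintegral_Pout hΔ x]
  exact ENNReal.one_lt_top

lemma ChannelRegular.integral_Pout {K : ℝ} (hf : ChannelRegular f K) (hΔ : 0 < Δ) (x : ℝ) :
    ∫ y, Pout PA Δ f y x = 1 := by
  rw [integral_eq_lintegral_of_nonneg_ae
    (Filter.Eventually.of_forall fun y => (hf.Pout_pos hΔ y x).le)
    (hf.integrable_Pout hΔ x).aestronglyMeasurable, hf.lintegral_Pout hΔ x, ENNReal.toReal_one]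

/-- The response `f(x; A) + √Δ Z` has conditional density `P_out(· | x)`. -/
lemma ChannelRegular.map_response {K : ℝ} (hf : ChannelRegular f K) (hΔ : 0 < Δ) (x : ℝ) :
    (stdG.prod PA).map (fun q => f x q.2 + Real.sqrt Δ * q.1) =
      volume.withDensity fun y => ENNReal.ofReal (Pout PA Δ f y x) := by
  have hx : Measurable (f x) := hf.measurable_comp measurable_const measurable_id
  have hm : Measurable fun q : ℝ × (Fin p → ℝ) => ENNReal.ofReal (noiseDensity Δ (q.1 - f x q.2)) :=
    (hf.measurable_noise.comp
      (f := fun q : ℝ × (Fin p → ℝ) => ((q.1, x), q.2)) (by fun_prop)).ennreal_ofReal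
  have hlaw : ∀ m : ℝ, stdG.map (fun z => m + Real.sqrt Δ * z) = gaussianReal m Δ.toNNReal := by
    intro m
    have h : (fun z => m + Real.sqrt Δ * z) = (m + ·) ∘ (Real.sqrt Δ * ·) := rfl
    rw [h, ← Measure.map_map (by fun_prop) (by fun_prop), stdG, gaussianReal_map_const_mul,
      gaussianReal_map_const_add]
    congr 1
    · simp
    · ext; simp [hΔ.le]
  refine Measure.ext_of_lintegral _ fun g hg => ?_
  have hcomp : Measurable fun q : ℝ × (Fin p → ℝ) => f x q.2 + Real.sqrt Δ * q.1 := by fun_prop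
  have hP : Measurable fun y => ENNReal.ofReal (Pout PA Δ f y x) :=
    (hf.measurable_Pout.comp (f := fun y : ℝ => (y, x)) (by fun_prop)).ennreal_ofReal
  rw [lintegral_map hg hcomp,
    lintegral_prod_symm (fun q : ℝ × (Fin p → ℝ) => g (f x q.2 + Real.sqrt Δ * q.1))
      (hg.comp hcomp).aemeasurable,
    lintegral_withDensity_eq_lintegral_mul _ hP hg]
  have h1 : ∀ A, ∫⁻ z, g (f x A + Real.sqrt Δ * z) ∂stdG =
      ∫⁻ y, ENNReal.ofReal (noiseDensity Δ (y - f x A)) * g y := by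
    intro A
    rw [← lintegral_map hg (by fun_prop : Measurable fun z => f x A + Real.sqrt Δ * z), hlaw,
      gaussianReal_of_var_ne_zero _ (Real.toNNReal_pos.2 hΔ).ne',
      lintegral_withDensity_eq_lintegral_mul _ (measurable_gaussianPDF _ _) hg]
    simp_rw [noiseDensity_eq_gaussianPDFReal hΔ]
    rfl
  simp_rw [h1]
  rw [lintegral_lintegral_swap (by
    exact ((hm.comp measurable_swap).mul (hg.comp measurable_snd)).aemeasurable)]
  refine lintegral_congr fun y => ?_
  rw [Pi.mul_apply, Pout_eq, ofReal_integral_eq_lintegral_ofReal (hf.integrable_noise hΔ y x)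
    (Filter.Eventually.of_forall fun A => (noiseDensity_pos hΔ _).le)]
  exact lintegral_mul_const _ (hm.comp (f := fun A : Fin p → ℝ => (y, A)) (by fun_prop))

end Channel

lemma pi_withDensity_ofReal {ι : Type*} [Fintype ι] {g : ι → ℝ → ℝ} (hg : ∀ i y, 0 ≤ g i y)
    (hgi : ∀ i, Integrable (g i)) :
    Measure.pi (fun i => (volume : Measure ℝ).withDensity fun y => ENNReal.ofReal (g i y)) =
      (volume : Measure (ι → ℝ)).withDensity fun y => ENNReal.ofReal (∏ i, g i (y i)) := by
  have hfin : ∀ i, IsFiniteMeasure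
      ((volume : Measure ℝ).withDensity fun y => ENNReal.ofReal (g i y)) := fun i =>
    isFiniteMeasure_withDensity_ofReal (hgi i).hasFiniteIntegral
  refine Measure.pi_eq fun t ht => ?_
  rw [withDensity_apply _ (MeasurableSet.univ_pi ht), volume_pi, Measure.restrict_pi_pi]
  have hint := Integrable.fintype_prod_dep (μ := fun i => (volume : Measure ℝ).restrict (t i))
    (f := g) fun i => (hgi i).restrict
  rw [← ofReal_integral_eq_lintegral_ofReal hint
    (Filter.Eventually.of_forall fun y => Finset.prod_nonneg fun i _ => hg i _),
    integral_fintype_prod_eq_prod, ENNReal.ofReal_prod_of_nonneg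
      fun i _ => integral_nonneg (hg i)]
  refine Finset.prod_congr rfl fun i _ => ?_
  rw [withDensity_apply _ (ht i), ofReal_integral_eq_lintegral_ofReal (hgi i).restrict
    (Filter.Eventually.of_forall (hg i))]

section Rearrange

variable {α β γ δ : Type*} [MeasurableSpace α] [MeasurableSpace β] [MeasurableSpace γ]
  [MeasurableSpace δ]

lemma measurePreserving_prodAssoc_symm (a : Measure α) (b : Measure β) (c : Measure γ)
    [SFinite a] [SFinite b] [SFinite c] :
    MeasurePreserving (fun q : α × β × γ => ((q.1, q.2.1), q.2.2)) (a.prod (b.prod c))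
      ((a.prod b).prod c) :=
  (measurePreserving_prodAssoc a b c).symm

lemma measurePreserving_prodAssoc_fun (a : Measure α) (b : Measure β) (c : Measure γ)
    [SFinite a] [SFinite b] [SFinite c] :
    MeasurePreserving (fun q : (α × β) × γ => (q.1.1, q.1.2, q.2)) ((a.prod b).prod c)
      (a.prod (b.prod c)) :=
  measurePreserving_prodAssoc a b c

lemma measurePreserving_prod_right_comm (a : Measure α) (b : Measure β) (c : Measure γ)
    [SFinite a] [SFinite b] [SFinite c] :
    MeasurePreserving (fun q : (α × β) × γ => ((q.1.1, q.2), q.1.2)) ((a.prod b).prod c)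
      ((a.prod c).prod b) :=
  (measurePreserving_prodAssoc_symm a c b).comp
    (((MeasurePreserving.id a).prod (Measure.measurePreserving_swap (μ := b) (ν := c))).comp
      (measurePreserving_prodAssoc_fun a b c))

lemma measurePreserving_prod_prod_comm (a : Measure α) (b : Measure β) (c : Measure γ)
    (d : Measure δ) [SFinite a] [SFinite b] [SFinite c] [SFinite d] :
    MeasurePreserving (fun q : (α × β) × γ × δ => ((q.1.1, q.2.1), (q.1.2, q.2.2)))
      ((a.prod b).prod (c.prod d)) ((a.prod c).prod (b.prod d)) :=
  (measurePreserving_prodAssoc_fun (a.prod c) b d).comp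
    (((measurePreserving_prod_right_comm a b c).prod (MeasurePreserving.id d)).comp
      (measurePreserving_prodAssoc_symm (a.prod b) c d))

lemma measurePreserving_regroup {𝒲 𝒜 𝒱 𝒞 : Type*} [MeasurableSpace 𝒲] [MeasurableSpace 𝒜]
    [MeasurableSpace 𝒱] [MeasurableSpace 𝒞] (x : Measure α) (ζ : Measure β) (z : Measure γ)
    (k : Measure 𝒞) (w : Measure 𝒲) (a : Measure 𝒜) (v : Measure 𝒱) [SFinite x] [SFinite ζ]
    [SFinite z] [SFinite k] [SFinite w] [SFinite a] [SFinite v] :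
    MeasurePreserving (fun ω : (α × β × γ) × 𝒞 × 𝒲 × 𝒜 × 𝒱 =>
      ((ω.1.1, (ω.2.2.1, ω.2.2.2.1, ω.2.2.2.2, ω.1.2.1)), (ω.1.2.2, ω.2.1)))
      ((x.prod (ζ.prod z)).prod (k.prod (w.prod (a.prod v))))
      ((x.prod (w.prod (a.prod (v.prod ζ)))).prod (z.prod k)) := by
  have h0 := ((MeasurePreserving.id w).prod (measurePreserving_prodAssoc_fun a v ζ)).comp
    (measurePreserving_prodAssoc_fun w (a.prod v) ζ)
  have h1 := (measurePreserving_prod_prod_comm x (ζ.prod z) (w.prod (a.prod v)) k).comp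
    ((MeasurePreserving.id (x.prod (ζ.prod z))).prod
      (Measure.measurePreserving_swap (μ := k) (ν := w.prod (a.prod v))))
  have h2 := measurePreserving_prodAssoc_symm (x.prod (w.prod (a.prod v))) ζ (z.prod k)
  have h3 := (MeasurePreserving.id (x.prod (w.prod (a.prod v)))).prod
    (measurePreserving_prodAssoc_fun ζ z k)
  have h4 := (((MeasurePreserving.id x).prod h0).comp
    (measurePreserving_prodAssoc_fun x (w.prod (a.prod v)) ζ)).prod
    (MeasurePreserving.id (z.prod k))
  exact h4.comp (h2.comp (h3.comp h1))

end Rearrange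

/-- The inputs together with the student variables. -/
abbrev inputStudSpace (d : ℕ → ℕ) (L n : ℕ) := (Fin n → Fin (d 0) → ℝ) × studSpace d L n

/-- The law of the inputs. -/
def inputMeasure (d : ℕ → ℕ) (n : ℕ) : Measure (Fin n → Fin (d 0) → ℝ) :=
  Measure.pi fun _ => stdGPi (d 0)

instance (d : ℕ → ℕ) (n : ℕ) : IsProbabilityMeasure (inputMeasure d n) := by
  unfold inputMeasure; infer_instance

/-- The teacher variables, arranged as a student replica. -/
def teacherReplica {d : ℕ → ℕ} {L p n : ℕ} (ω : interpSpace d L p n) : studSpace d L n :=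
  (ω.2.2.1, ω.2.2.2.1, ω.2.2.2.2, ω.1.2.1)

lemma measurePreserving_rearrange (d : ℕ → ℕ) (L p n : ℕ) (PA : Measure (Fin p → ℝ))
    [IsProbabilityMeasure PA] :
    MeasurePreserving (fun ω : interpSpace d L p n => ((ω.1.1, teacherReplica ω), (ω.1.2.2, ω.2.1)))
      (interpMeasure d L p n PA)
      (((inputMeasure d n).prod (studMeasure d L n)).prod
        ((stdGPi n).prod (psi2Measure p n PA))) :=
  measurePreserving_regroup (inputMeasure d n) (stdGPi n) (stdGPi n) (psi2Measure p n PA)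
    (Wmeasure d L) (stdGPi (d L)) (stdGPi (d (L - 1)))

section Posterior

variable {p n : ℕ} {PA : Measure (Fin p → ℝ)} [IsProbabilityMeasure PA] {Δ : ℝ}
  {f : ℝ → (Fin p → ℝ) → ℝ} {K : ℝ}

/-- The likelihood of the responses `y` given the signals `s`. -/
def likelihood (PA : Measure (Fin p → ℝ)) (Δ : ℝ) (f : ℝ → (Fin p → ℝ) → ℝ)
    (y s : Fin n → ℝ) : ℝ := ∏ μi, Pout PA Δ f (y μi) (s μi)

lemma ChannelRegular.likelihood_pos (hf : ChannelRegular f K) (hΔ : 0 < Δ) (y s : Fin n → ℝ) :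
    0 < likelihood PA Δ f y s :=
  Finset.prod_pos fun _ _ => hf.Pout_pos hΔ _ _

lemma ChannelRegular.likelihood_le (hf : ChannelRegular f K) (hΔ : 0 < Δ) (y s : Fin n → ℝ) :
    likelihood PA Δ f y s ≤ (Real.sqrt (2 * Real.pi * Δ))⁻¹ ^ n := by
  have h := Finset.prod_le_prod (s := Finset.univ) (f := fun μi => Pout PA Δ f (y μi) (s μi))
    (g := fun _ : Fin n => (Real.sqrt (2 * Real.pi * Δ))⁻¹)
    (fun _ _ => (hf.Pout_pos hΔ _ _).le) fun _ _ => hf.Pout_le hΔ _ _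
  simpa [likelihood] using h

lemma ChannelRegular.measurable_likelihood (hf : ChannelRegular f K) :
    Measurable fun q : (Fin n → ℝ) × (Fin n → ℝ) => likelihood PA Δ f q.1 q.2 := by
  unfold likelihood
  refine Finset.measurable_fun_prod _ fun μi _ => ?_
  exact hf.measurable_Pout.comp
    (f := fun q : (Fin n → ℝ) × (Fin n → ℝ) => (q.1 μi, q.2 μi)) (by fun_prop)

lemma ChannelRegular.map_responses (hf : ChannelRegular f K) (hΔ : 0 < Δ) (s : Fin n → ℝ) :
    ((stdGPi n).prod (psi2Measure p n PA)).map
        (fun q μi => f (s μi) (q.2 μi) + Real.sqrt Δ * q.1 μi) =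
      volume.withDensity fun y => ENNReal.ofReal (likelihood PA Δ f y s) := by
  have hm : ∀ μi, Measurable fun q : ℝ × (Fin p → ℝ) => f (s μi) q.2 + Real.sqrt Δ * q.1 :=
    fun μi => (hf.measurable_comp measurable_const measurable_snd).add (by fun_prop)
  have hmp := measurePreserving_arrowProdEquivProdArrow ℝ (Fin p → ℝ) (Fin n)
    (fun _ => stdG) (fun _ => PA)
  have hprob : ∀ μi, IsProbabilityMeasure
      ((stdG.prod PA).map fun q => f (s μi) q.2 + Real.sqrt Δ * q.1) :=
    fun μi => Measure.isProbabilityMeasure_map (hm μi).aemeasurable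
  have hpi := Measure.pi_map_pi (μ := fun _ : Fin n => stdG.prod PA)
    (f := fun μi q => f (s μi) q.2 + Real.sqrt Δ * q.1) fun μi => (hm μi).aemeasurable
  have hM : Measurable fun (q : (Fin n → ℝ) × (Fin n → Fin p → ℝ)) (μi : Fin n) =>
      f (s μi) (q.2 μi) + Real.sqrt Δ * q.1 μi :=
    measurable_pi_lambda _ fun μi => (hm μi).comp
      (f := fun q : (Fin n → ℝ) × (Fin n → Fin p → ℝ) => (q.1 μi, q.2 μi)) (by fun_prop)
  unfold stdGPi psi2Measure
  rw [← hmp.map_eq, Measure.map_map hM hmp.measurable]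
  refine hpi.trans ?_
  simp_rw [hf.map_response hΔ]
  exact pi_withDensity_ofReal (fun μi y => (hf.Pout_pos hΔ y (s μi)).le)
    fun μi => hf.integrable_Pout hΔ (s μi)

/-- The score `∑ u′(s_μ) c_μ`, weighted by the likelihood. -/
def weightedScore (PA : Measure (Fin p → ℝ)) (Δ : ℝ) (f : ℝ → (Fin p → ℝ) → ℝ)
    (y s c : Fin n → ℝ) : ℝ :=
  (∑ μi, uD1 PA Δ f (y μi) (s μi) * c μi) * likelihood PA Δ f y s

/-- The factors of the likelihood with the factor of index `μi` differentiated. -/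
def scoreFactor (PA : Measure (Fin p → ℝ)) (Δ : ℝ) (f : ℝ → (Fin p → ℝ) → ℝ)
    (s : Fin n → ℝ) (μi νi : Fin n) (y : ℝ) : ℝ :=
  if νi = μi then dPout PA Δ f y (s νi) else Pout PA Δ f y (s νi)

lemma ChannelRegular.weightedScore_eq (hf : ChannelRegular f K) (hΔ : 0 < Δ)
    (y s c : Fin n → ℝ) :
    weightedScore PA Δ f y s c = ∑ μi, c μi * ∏ νi, scoreFactor PA Δ f s μi νi (y νi) := by
  rw [weightedScore, Finset.sum_mul]
  refine Finset.sum_congr rfl fun μi _ => ?_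
  rw [likelihood, ← Finset.mul_prod_erase _ _ (Finset.mem_univ μi),
    ← Finset.mul_prod_erase _ (fun νi => scoreFactor PA Δ f s μi νi (y νi)) (Finset.mem_univ μi),
    scoreFactor, if_pos rfl, ← hf.uD1_mul_Pout hΔ]
  have h : ∏ νi ∈ Finset.univ.erase μi, scoreFactor PA Δ f s μi νi (y νi) =
      ∏ νi ∈ Finset.univ.erase μi, Pout PA Δ f (y νi) (s νi) :=
    Finset.prod_congr rfl fun νi hν => by
      rw [scoreFactor, if_neg (Finset.ne_of_mem_erase hν)]
  rw [h]
  ring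

lemma ChannelRegular.measurable_scoreFactor (hf : ChannelRegular f K) (μi νi : Fin n) :
    Measurable fun q : (Fin n → ℝ) × ℝ => scoreFactor PA Δ f q.1 μi νi q.2 := by
  have hp : Measurable fun q : (Fin n → ℝ) × ℝ => (q.2, q.1 νi) := by fun_prop
  by_cases h : νi = μi
  · simp only [scoreFactor, if_pos h]
    exact (hf.measurable_dPout (PA := PA) (Δ := Δ)).comp
      (f := fun q : (Fin n → ℝ) × ℝ => (q.2, q.1 νi)) hp
  · simp only [scoreFactor, if_neg h]
    exact (hf.measurable_Pout (PA := PA) (Δ := Δ)).comp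
      (f := fun q : (Fin n → ℝ) × ℝ => (q.2, q.1 νi)) hp

lemma ChannelRegular.integrable_scoreFactor (hf : ChannelRegular f K) (hΔ : 0 < Δ)
    (s : Fin n → ℝ) (μi νi : Fin n) : Integrable (scoreFactor PA Δ f s μi νi) := by
  unfold scoreFactor
  split_ifs
  exacts [hf.integrable_dPout hΔ _, hf.integrable_Pout hΔ _]

lemma ChannelRegular.integrable_prod_scoreFactor (hf : ChannelRegular f K) (hΔ : 0 < Δ)
    (s : Fin n → ℝ) (μi : Fin n) :
    Integrable fun y : Fin n → ℝ => ∏ νi, scoreFactor PA Δ f s μi νi (y νi) :=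
  Integrable.fintype_prod_dep fun νi => hf.integrable_scoreFactor hΔ s μi νi

lemma ChannelRegular.integral_prod_scoreFactor (hf : ChannelRegular f K) (hΔ : 0 < Δ)
    (s : Fin n → ℝ) (μi : Fin n) :
    ∫ y : Fin n → ℝ, ∏ νi, scoreFactor PA Δ f s μi νi (y νi) = 0 := by
  rw [integral_fintype_prod_volume_eq_prod]
  refine Finset.prod_eq_zero (Finset.mem_univ μi) ?_
  simp only [scoreFactor, if_true]
  exact hf.integral_dPout hΔ _

lemma ChannelRegular.integral_norm_prod_scoreFactor_le (hf : ChannelRegular f K) (hΔ : 0 < Δ)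
    (s : Fin n → ℝ) (μi : Fin n) :
    ∫ y : Fin n → ℝ, ‖∏ νi, scoreFactor PA Δ f s μi νi (y νi)‖ ≤ dPoutBound Δ K := by
  simp_rw [norm_prod]
  rw [integral_fintype_prod_volume_eq_prod fun νi y => ‖scoreFactor PA Δ f s μi νi y‖,
    ← Finset.mul_prod_erase _ _ (Finset.mem_univ μi), Finset.prod_eq_one, mul_one]
  · simp only [scoreFactor, if_true]
    exact hf.integral_norm_dPout_le hΔ _
  · intro νi hν
    simp only [scoreFactor, if_neg (Finset.ne_of_mem_erase hν),
      Real.norm_of_nonneg (hf.Pout_pos hΔ _ _).le]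
    exact hf.integral_Pout hΔ _

lemma ChannelRegular.integral_weightedScore (hf : ChannelRegular f K) (hΔ : 0 < Δ)
    (s c : Fin n → ℝ) : ∫ y, weightedScore PA Δ f y s c = 0 := by
  simp_rw [hf.weightedScore_eq hΔ]
  rw [integral_finsetSum _ fun μi _ => (hf.integrable_prod_scoreFactor hΔ s μi).const_mul _]
  simp_rw [integral_const_mul, hf.integral_prod_scoreFactor hΔ, mul_zero, Finset.sum_const_zero]

lemma ChannelRegular.integrable_weightedScore (hf : ChannelRegular f K) (hΔ : 0 < Δ)
    {Q : Type*} [MeasurableSpace Q] (P : Measure Q) [SFinite P] {s c : Q → Fin n → ℝ}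
    (hs : Measurable s) (hc : ∀ μi, Integrable (fun q => c q μi) P) :
    Integrable (fun z : Q × (Fin n → ℝ) => weightedScore PA Δ f z.2 (s z.1) (c z.1))
      (P.prod volume) := by
  simp_rw [hf.weightedScore_eq hΔ]
  refine integrable_finsetSum _ fun μi _ => ?_
  have hm : Measurable fun z : Q × (Fin n → ℝ) =>
      ∏ νi, scoreFactor PA Δ f (s z.1) μi νi (z.2 νi) := by
    refine Finset.measurable_fun_prod _ fun νi _ => ?_
    exact (hf.measurable_scoreFactor μi νi).comp
      (f := fun z : Q × (Fin n → ℝ) => (s z.1, z.2 νi)) (by fun_prop)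
  have hae : AEStronglyMeasurable (fun z : Q × (Fin n → ℝ) =>
      c z.1 μi * ∏ νi, scoreFactor PA Δ f (s z.1) μi νi (z.2 νi)) (P.prod volume) :=
    (hc μi).aestronglyMeasurable.comp_fst.mul hm.aestronglyMeasurable
  rw [integrable_prod_iff hae]
  refine ⟨Filter.Eventually.of_forall fun q =>
    (hf.integrable_prod_scoreFactor (PA := PA) hΔ (s q) μi).const_mul (c q μi), ?_⟩
  refine ((hc μi).norm.mul_const (dPoutBound Δ K)).mono' hae.norm.integral_prod_right'
    (Filter.Eventually.of_forall fun q => ?_)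
  rw [Real.norm_of_nonneg (integral_nonneg fun _ => norm_nonneg _)]
  simp_rw [norm_mul]
  rw [integral_const_mul]
  exact mul_le_mul_of_nonneg_left (hf.integral_norm_prod_scoreFactor_le hΔ (s q) μi)
    (norm_nonneg _)

variable {𝒳 𝒯 : Type*} [MeasurableSpace 𝒳] [MeasurableSpace 𝒯]

lemma ChannelRegular.integrable_weightedScore_comm (hf : ChannelRegular f K) (hΔ : 0 < Δ)
    (a : Measure 𝒳) (b : Measure 𝒯) [SFinite a] [SFinite b] {s c : 𝒳 × 𝒯 → Fin n → ℝ}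
    (hs : Measurable s) (hc : ∀ μi, Integrable (fun q => c q μi) (a.prod b)) :
    Integrable (fun w : (𝒳 × (Fin n → ℝ)) × 𝒯 =>
      weightedScore PA Δ f w.1.2 (s (w.1.1, w.2)) (c (w.1.1, w.2))) ((a.prod volume).prod b) :=
  (measurePreserving_prod_right_comm a (volume : Measure (Fin n → ℝ)) b
    ).integrable_comp_of_integrable (hf.integrable_weightedScore (PA := PA) hΔ (a.prod b) hs hc)

/-- Averaged over the unnormalised posterior and the responses, the score vanishes. -/
lemma ChannelRegular.integral_integral_weightedScore (hf : ChannelRegular f K) (hΔ : 0 < Δ)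
    (a : Measure 𝒳) (b : Measure 𝒯) [SFinite a] [SFinite b] {s c : 𝒳 × 𝒯 → Fin n → ℝ}
    (hs : Measurable s) (hc : ∀ μi, Integrable (fun q => c q μi) (a.prod b)) :
    ∫ z : 𝒳 × (Fin n → ℝ), ∫ τ, weightedScore PA Δ f z.2 (s (z.1, τ)) (c (z.1, τ)) ∂b
      ∂(a.prod volume) = 0 := by
  have hG := hf.integrable_weightedScore (PA := PA) hΔ (a.prod b) hs hc
  have hr := measurePreserving_prod_right_comm a (volume : Measure (Fin n → ℝ)) b
  rw [← integral_prod (fun z : (𝒳 × (Fin n → ℝ)) × 𝒯 =>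
    weightedScore PA Δ f z.1.2 (s (z.1.1, z.2)) (c (z.1.1, z.2)))
    (hf.integrable_weightedScore_comm (PA := PA) hΔ a b hs hc)]
  have h := integral_map hr.aemeasurable (f := fun z : (𝒳 × 𝒯) × (Fin n → ℝ) =>
    weightedScore PA Δ f z.2 (s z.1) (c z.1)) (by
      rw [hr.map_eq]; exact hG.aestronglyMeasurable)
  rw [← h, hr.map_eq, integral_prod _ hG]
  simp_rw [hf.integral_weightedScore hΔ, integral_zero]

/-- The evidence `∫ ∏ P_out(y_μ | s_μ)`. -/
def evidence (PA : Measure (Fin p → ℝ)) (Δ : ℝ) (f : ℝ → (Fin p → ℝ) → ℝ) (b : Measure 𝒯)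
    (s : 𝒳 × 𝒯 → Fin n → ℝ) (z : 𝒳 × (Fin n → ℝ)) : ℝ :=
  ∫ τ, likelihood PA Δ f z.2 (s (z.1, τ)) ∂b

lemma ChannelRegular.measurable_likelihood_comp (hf : ChannelRegular f K)
    {s : 𝒳 × 𝒯 → Fin n → ℝ} (hs : Measurable s) :
    Measurable fun w : (𝒳 × (Fin n → ℝ)) × 𝒯 => likelihood PA Δ f w.1.2 (s (w.1.1, w.2)) :=
  hf.measurable_likelihood.comp
    (f := fun w : (𝒳 × (Fin n → ℝ)) × 𝒯 => (w.1.2, s (w.1.1, w.2))) (by fun_prop)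

lemma ChannelRegular.integrable_likelihood (hf : ChannelRegular f K) (hΔ : 0 < Δ) (b : Measure 𝒯)
    [IsProbabilityMeasure b] {s : 𝒳 × 𝒯 → Fin n → ℝ} (hs : Measurable s)
    (z : 𝒳 × (Fin n → ℝ)) :
    Integrable (fun τ => likelihood PA Δ f z.2 (s (z.1, τ))) b := by
  refine Integrable.of_bound (C := (Real.sqrt (2 * Real.pi * Δ))⁻¹ ^ n) ?_
    (Filter.Eventually.of_forall fun τ => ?_)
  · exact ((hf.measurable_likelihood_comp hs).comp
      (f := fun τ : 𝒯 => (z, τ)) (by fun_prop)).aestronglyMeasurable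
  · rw [Real.norm_of_nonneg (hf.likelihood_pos hΔ _ _).le]
    exact hf.likelihood_le hΔ _ _

lemma ChannelRegular.evidence_pos (hf : ChannelRegular f K) (hΔ : 0 < Δ) (b : Measure 𝒯)
    [IsProbabilityMeasure b] {s : 𝒳 × 𝒯 → Fin n → ℝ} (hs : Measurable s)
    (z : 𝒳 × (Fin n → ℝ)) : 0 < evidence PA Δ f b s z := by
  rw [evidence, integral_pos_iff_support_of_nonneg (fun τ => (hf.likelihood_pos hΔ _ _).le)
    (hf.integrable_likelihood hΔ b hs z),
    show Function.support (fun τ => likelihood PA Δ f z.2 (s (z.1, τ))) = Set.univ from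
      Set.eq_univ_of_forall fun τ => (hf.likelihood_pos hΔ _ _).ne']
  simp

lemma ChannelRegular.measurable_evidence (hf : ChannelRegular f K) (b : Measure 𝒯)
    [IsProbabilityMeasure b] {s : 𝒳 × 𝒯 → Fin n → ℝ} (hs : Measurable s) :
    Measurable (evidence PA Δ f b s) :=
  (hf.measurable_likelihood_comp hs).stronglyMeasurable.integral_prod_right'.measurable

lemma ChannelRegular.measurable_inputResponse (hf : ChannelRegular f K)
    {s : 𝒳 × 𝒯 → Fin n → ℝ} (hs : Measurable s) :
    Measurable fun r : (𝒳 × 𝒯) × (Fin n → ℝ) × (Fin n → Fin p → ℝ) =>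
      (r.1.1, fun μi => f (s r.1 μi) (r.2.2 μi) + Real.sqrt Δ * r.2.1 μi) := by
  refine Measurable.prodMk (by fun_prop) (measurable_pi_lambda _ fun μi => ?_)
  exact (hf.measurable_comp ((measurable_pi_apply μi).comp (hs.comp measurable_fst))
    (by fun_prop)).add (by fun_prop)

lemma ChannelRegular.lintegral_responses (hf : ChannelRegular f K) (hΔ : 0 < Δ) (s : Fin n → ℝ)
    {g : (Fin n → ℝ) → ENNReal} (hg : Measurable g) :
    ∫⁻ r, g (fun μi => f (s μi) (r.2 μi) + Real.sqrt Δ * r.1 μi)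
      ∂((stdGPi n).prod (psi2Measure p n PA)) =
      ∫⁻ y, ENNReal.ofReal (likelihood PA Δ f y s) * g y := by
  have hY : Measurable fun (r : (Fin n → ℝ) × (Fin n → Fin p → ℝ)) (μi : Fin n) =>
      f (s μi) (r.2 μi) + Real.sqrt Δ * r.1 μi :=
    measurable_pi_lambda _ fun μi =>
      (hf.measurable_comp measurable_const (by fun_prop)).add (by fun_prop)
  have hl : Measurable fun y : Fin n → ℝ => ENNReal.ofReal (likelihood PA Δ f y s) :=
    (hf.measurable_likelihood.comp (f := fun y : Fin n → ℝ => (y, s)) (by fun_prop)).ennreal_ofReal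
  rw [← lintegral_map hg hY, hf.map_responses hΔ, lintegral_withDensity_eq_lintegral_mul _ hl hg]
  rfl

lemma ChannelRegular.lintegral_likelihood (hf : ChannelRegular f K) (hΔ : 0 < Δ) (b : Measure 𝒯)
    [IsProbabilityMeasure b] {s : 𝒳 × 𝒯 → Fin n → ℝ} (hs : Measurable s)
    (z : 𝒳 × (Fin n → ℝ)) :
    ∫⁻ τ, ENNReal.ofReal (likelihood PA Δ f z.2 (s (z.1, τ))) ∂b =
      ENNReal.ofReal (evidence PA Δ f b s z) :=
  (ofReal_integral_eq_lintegral_ofReal (hf.integrable_likelihood hΔ b hs z)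
    (Filter.Eventually.of_forall fun _ => (hf.likelihood_pos hΔ _ _).le)).symm

lemma ChannelRegular.lintegral_evidence_mul (hf : ChannelRegular f K) (hΔ : 0 < Δ)
    (a : Measure 𝒳) (b : Measure 𝒯) [SFinite a] [IsProbabilityMeasure b]
    {s : 𝒳 × 𝒯 → Fin n → ℝ} (hs : Measurable s) {g : 𝒳 × (Fin n → ℝ) → ENNReal}
    (hg : Measurable g) :
    ∫⁻ z, ENNReal.ofReal (evidence PA Δ f b s z) * g z ∂(a.prod volume) =
      ∫⁻ q, (∫⁻ y, ENNReal.ofReal (likelihood PA Δ f y (s q)) * g (q.1, y)) ∂(a.prod b) := by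
  have hl := (hf.measurable_likelihood_comp (PA := PA) (Δ := Δ) hs).ennreal_ofReal
  have hgl : Measurable fun w : (𝒳 × (Fin n → ℝ)) × 𝒯 =>
      ENNReal.ofReal (likelihood PA Δ f w.1.2 (s (w.1.1, w.2))) * g w.1 :=
    hl.mul (hg.comp measurable_fst)
  have hr := measurePreserving_prod_right_comm a (volume : Measure (Fin n → ℝ)) b
  have hgl' : Measurable fun w : (𝒳 × 𝒯) × (Fin n → ℝ) =>
      ENNReal.ofReal (likelihood PA Δ f w.2 (s w.1)) * g (w.1.1, w.2) :=
    hgl.comp (f := fun q : (𝒳 × 𝒯) × (Fin n → ℝ) => ((q.1.1, q.2), q.1.2)) (by fun_prop)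
  have hswap := hr.lintegral_comp hgl'
  rw [lintegral_prod _ hgl'.aemeasurable, lintegral_prod (fun w : (𝒳 × (Fin n → ℝ)) × 𝒯 =>
    ENNReal.ofReal (likelihood PA Δ f w.1.2 (s (w.1.1, w.2))) * g w.1) hgl.aemeasurable] at hswap
  rw [← hswap]
  refine lintegral_congr fun z => ?_
  have hlz : Measurable fun τ => ENNReal.ofReal (likelihood PA Δ f z.2 (s (z.1, τ))) :=
    hl.comp (f := fun τ : 𝒯 => (z, τ)) (by fun_prop)
  rw [← hf.lintegral_likelihood hΔ b hs z]
  exact (lintegral_mul_const _ hlz).symm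

/-- The joint law of inputs and responses has the evidence as density. -/
lemma ChannelRegular.map_inputResponse (hf : ChannelRegular f K) (hΔ : 0 < Δ)
    (a : Measure 𝒳) (b : Measure 𝒯) [SFinite a] [IsProbabilityMeasure b]
    {s : 𝒳 × 𝒯 → Fin n → ℝ} (hs : Measurable s) :
    ((a.prod b).prod ((stdGPi n).prod (psi2Measure p n PA))).map
        (fun r => (r.1.1, fun μi => f (s r.1 μi) (r.2.2 μi) + Real.sqrt Δ * r.2.1 μi)) =
      (a.prod volume).withDensity fun z => ENNReal.ofReal (evidence PA Δ f b s z) := by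
  have hT := hf.measurable_inputResponse (Δ := Δ) hs
  have hE := (hf.measurable_evidence (PA := PA) (Δ := Δ) b hs).ennreal_ofReal
  refine Measure.ext_of_lintegral _ fun g hg => ?_
  have hgq : ∀ q : 𝒳 × 𝒯, Measurable fun y : Fin n → ℝ => g (q.1, y) :=
    fun q => hg.comp (by fun_prop)
  have hgT : Measurable fun r : (𝒳 × 𝒯) × (Fin n → ℝ) × (Fin n → Fin p → ℝ) =>
      g (r.1.1, fun μi => f (s r.1 μi) (r.2.2 μi) + Real.sqrt Δ * r.2.1 μi) := hg.comp hT
  rw [lintegral_map hg hT, lintegral_prod _ hgT.aemeasurable,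
    lintegral_withDensity_eq_lintegral_mul _ hE hg]
  refine Eq.trans (lintegral_congr fun q => ?_)
    (hf.lintegral_evidence_mul (PA := PA) hΔ a b hs hg).symm
  exact hf.lintegral_responses hΔ (s q) (hgq q)

/-- The quenched average of the posterior mean of the score vanishes. -/
lemma ChannelRegular.integral_posterior_score (hf : ChannelRegular f K) (hΔ : 0 < Δ)
    (a : Measure 𝒳) (b : Measure 𝒯) [SFinite a] [IsProbabilityMeasure b]
    {s c : 𝒳 × 𝒯 → Fin n → ℝ} (hs : Measurable s)
    (hc : ∀ μi, Integrable (fun q => c q μi) (a.prod b)) :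
    ∫ z, (∫ τ, weightedScore PA Δ f z.2 (s (z.1, τ)) (c (z.1, τ)) ∂b) / evidence PA Δ f b s z
      ∂((a.prod volume).withDensity fun z => ENNReal.ofReal (evidence PA Δ f b s z)) = 0 := by
  rw [integral_withDensity_eq_integral_toReal_smul
    (hf.measurable_evidence b hs).ennreal_ofReal
    (Filter.Eventually.of_forall fun _ => ENNReal.ofReal_lt_top),
    ← hf.integral_integral_weightedScore (PA := PA) hΔ a b hs hc]
  refine integral_congr_ae (Filter.Eventually.of_forall fun z => ?_)
  have h := hf.evidence_pos (PA := PA) hΔ b hs z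
  simp only [ENNReal.toReal_ofReal h.le, smul_eq_mul]
  exact mul_div_cancel₀ _ h.ne'

end Posterior

section Moments

open scoped ENNReal

variable {Q R : Type*} [MeasurableSpace Q] [MeasurableSpace R] {P : Measure Q} {P' : Measure R}

/-- A measurable function all of whose moments are finite. -/
structure HasMoments (g : Q → ℝ) (P : Measure Q) : Prop where
  measurable : Measurable g
  memLp : ∀ q : ℝ≥0∞, q ≠ ∞ → MemLp g q P

lemma HasMoments.integrable {g : Q → ℝ} (hg : HasMoments g P) : Integrable g P :=
  memLp_one_iff_integrable.1 (hg.memLp 1 ENNReal.one_ne_top)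

lemma HasMoments.zero : HasMoments (fun _ => 0) P :=
  ⟨measurable_const, fun _ _ => MemLp.zero'⟩

lemma HasMoments.const_mul {g : Q → ℝ} (hg : HasMoments g P) (c : ℝ) :
    HasMoments (fun x => c * g x) P :=
  ⟨hg.measurable.const_mul c, fun q hq => (hg.memLp q hq).const_mul c⟩

lemma HasMoments.div_const {g : Q → ℝ} (hg : HasMoments g P) (c : ℝ) :
    HasMoments (fun x => g x / c) P := by
  simpa only [div_eq_inv_mul] using hg.const_mul c⁻¹

lemma HasMoments.add {g h : Q → ℝ} (hg : HasMoments g P) (hh : HasMoments h P) :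
    HasMoments (fun x => g x + h x) P :=
  ⟨hg.measurable.add hh.measurable, fun q hq => (hg.memLp q hq).add (hh.memLp q hq)⟩

lemma HasMoments.sum {ι : Type*} (s : Finset ι) {g : ι → Q → ℝ}
    (hg : ∀ i ∈ s, HasMoments (g i) P) : HasMoments (fun x => ∑ i ∈ s, g i x) P :=
  ⟨Finset.measurable_fun_sum s fun i hi => (hg i hi).measurable,
    fun q hq => memLp_finsetSum s fun i hi => (hg i hi).memLp q hq⟩

lemma HasMoments.mul {g h : Q → ℝ} (hg : HasMoments g P) (hh : HasMoments h P) :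
    HasMoments (fun x => g x * h x) P := by
  refine ⟨hg.measurable.mul hh.measurable, fun q hq => ?_⟩
  have hq2 : 2 * q ≠ ∞ := ENNReal.mul_ne_top ENNReal.ofNat_ne_top hq
  have : ENNReal.HolderTriple (2 * q) (2 * q) q := ⟨by
    rw [ENNReal.mul_inv (Or.inl two_ne_zero) (Or.inl ENNReal.ofNat_ne_top), ← add_mul,
      ENNReal.inv_two_add_inv_two, one_mul]⟩
  exact (hh.memLp _ hq2).mul (hg.memLp _ hq2)

lemma HasMoments.comp_of_le {g : Q → ℝ} (hg : HasMoments g P) {φ : ℝ → ℝ} (hφ : Measurable φ)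
    {K : ℝ} (hK : ∀ x, |φ x| ≤ K * |x|) : HasMoments (fun x => φ (g x)) P :=
  ⟨hφ.comp hg.measurable, fun q hq => (hg.memLp q hq).of_le_mul
    (hφ.comp hg.measurable).aestronglyMeasurable (Filter.Eventually.of_forall fun x => hK (g x))⟩

lemma HasMoments.comp_measurePreserving {g : R → ℝ} (hg : HasMoments g P') {π : Q → R}
    (hπ : MeasurePreserving π P P') : HasMoments (fun x => g (π x)) P :=
  ⟨hg.measurable.comp hπ.measurable, fun q hq => (hg.memLp q hq).comp_measurePreserving hπ⟩

lemma hasMoments_stdG : HasMoments (fun x => x) stdG :=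
  ⟨measurable_id, fun q hq => by
    lift q to NNReal using hq
    exact memLp_id_gaussianReal q⟩

lemma hasMoments_stdGPi {k : ℕ} (i : Fin k) : HasMoments (fun x => x i) (stdGPi k) :=
  hasMoments_stdG.comp_measurePreserving (measurePreserving_eval (fun _ : Fin k => stdG) i)

lemma hasMoments_Wmeasure {d : ℕ → ℕ} {L : ℕ} (ℓ : Fin L) (i : Fin (d ((ℓ : ℕ) + 1)))
    (j : Fin (d (ℓ : ℕ))) : HasMoments (fun W => W ℓ i j) (Wmeasure d L) :=
  ((hasMoments_stdGPi j).comp_measurePreserving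
    (measurePreserving_eval (fun _ : Fin (d ((ℓ : ℕ) + 1)) => stdGPi (d (ℓ : ℕ))) i)
    ).comp_measurePreserving (measurePreserving_eval
      (fun ℓ : Fin L => Measure.pi fun _ : Fin (d ((ℓ : ℕ) + 1)) => stdGPi (d (ℓ : ℕ))) ℓ)

lemma hasMoments_inputMeasure {d : ℕ → ℕ} {n : ℕ} (μi : Fin n) (j : Fin (d 0)) :
    HasMoments (fun X => X μi j) (inputMeasure d n) :=
  (hasMoments_stdGPi j).comp_measurePreserving
    (measurePreserving_eval (fun _ : Fin n => stdGPi (d 0)) μi)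

end Moments

lemma measurePreserving_input_response {φ : ℝ → ℝ} {p : ℕ} {PA : Measure (Fin p → ℝ)}
    [IsProbabilityMeasure PA] {Δ K : ℝ} {f : ℝ → (Fin p → ℝ) → ℝ} (hf : ChannelRegular f K) (hΔ : 0 < Δ) (d : ℕ → ℕ)
    (L n : ℕ) (t : ℝ)
    (hs : Measurable fun (q : inputStudSpace d L n) (μi : Fin n) => stI φ d L n t q.1 q.2 μi) :
    MeasurePreserving (fun ω : interpSpace d L p n => (ω.1.1, YtI φ f d L n Δ t ω))
      (interpMeasure d L p n PA)
      (((inputMeasure d n).prod volume).withDensity fun z => ENNReal.ofReal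
        (evidence PA Δ f (studMeasure d L n) (fun q μi => stI φ d L n t q.1 q.2 μi) z)) :=
  MeasurePreserving.comp (μb := ((inputMeasure d n).prod (studMeasure d L n)).prod
      ((stdGPi n).prod (psi2Measure p n PA)))
    ⟨hf.measurable_inputResponse hs, hf.map_inputResponse hΔ _ _ hs⟩
    (measurePreserving_rearrange d L p n PA)

section Network

variable {φ : ℝ → ℝ} {K : ℝ} (d : ℕ → ℕ) (L n : ℕ)

/-- The joint law of the inputs and of the student variables. -/
def inputStudMeasure (d : ℕ → ℕ) (L n : ℕ) : Measure (inputStudSpace d L n) :=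
  (inputMeasure d n).prod (studMeasure d L n)

instance (d : ℕ → ℕ) (L n : ℕ) : IsProbabilityMeasure (inputStudMeasure d L n) := by
  unfold inputStudMeasure; infer_instance

lemma measurePreserving_input :
    MeasurePreserving (fun q : inputStudSpace d L n => q.1) (inputStudMeasure d L n)
      (inputMeasure d n) := measurePreserving_fst

lemma measurePreserving_weights :
    MeasurePreserving (fun q : inputStudSpace d L n => q.2.1) (inputStudMeasure d L n)
      (Wmeasure d L) :=
  (measurePreserving_fst (μ := Wmeasure d L)).comp
    (measurePreserving_snd (μ := inputMeasure d n) (ν := studMeasure d L n))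

lemma measurePreserving_student_tail :
    MeasurePreserving (fun q : inputStudSpace d L n => q.2.2) (inputStudMeasure d L n)
      ((stdGPi (d L)).prod ((stdGPi (d (L - 1))).prod (stdGPi n))) :=
  (measurePreserving_snd (μ := Wmeasure d L)).comp
    (measurePreserving_snd (μ := inputMeasure d n) (ν := studMeasure d L n))

lemma measurePreserving_readout :
    MeasurePreserving (fun q : inputStudSpace d L n => q.2.2.1) (inputStudMeasure d L n)
      (stdGPi (d L)) :=
  measurePreserving_fst.comp (measurePreserving_student_tail d L n)

lemma measurePreserving_linear_readout :
    MeasurePreserving (fun q : inputStudSpace d L n => q.2.2.2.1) (inputStudMeasure d L n)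
      (stdGPi (d (L - 1))) :=
  measurePreserving_fst.comp (measurePreserving_snd.comp (measurePreserving_student_tail d L n))

lemma measurePreserving_student_noise :
    MeasurePreserving (fun q : inputStudSpace d L n => q.2.2.2.2) (inputStudMeasure d L n)
      (stdGPi n) :=
  measurePreserving_snd.comp (measurePreserving_snd.comp (measurePreserving_student_tail d L n))

lemma hasMoments_extW (ℓ : ℕ) (i : Fin (d (ℓ + 1))) (j : Fin (d ℓ)) :
    HasMoments (fun q : inputStudSpace d L n => extW q.2.1 ℓ i j) (inputStudMeasure d L n) := by
  by_cases h : ℓ < L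
  · simp only [extW, dif_pos h]
    exact (hasMoments_Wmeasure (d := d) ⟨ℓ, h⟩ i j).comp_measurePreserving
      (measurePreserving_weights d L n)
  · simp only [extW, dif_neg h]
    exact HasMoments.zero

lemma hasMoments_feat (hφ : Measurable φ) (hK : ∀ x, |φ x| ≤ K * |x|) (μi : Fin n) :
    ∀ (ℓ : ℕ) (i : Fin (d ℓ)),
      HasMoments (fun q : inputStudSpace d L n => feat φ d (extW q.2.1) (q.1 μi) ℓ i)
        (inputStudMeasure d L n)
  | 0, i => (hasMoments_inputMeasure μi i).comp_measurePreserving (measurePreserving_input d L n)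
  | ℓ + 1, i => HasMoments.comp_of_le
      ((HasMoments.sum Finset.univ fun j _ =>
        (hasMoments_extW d L n ℓ i j).mul (hasMoments_feat hφ hK μi ℓ j)).div_const _) hφ hK

lemma hasMoments_netOut (hφ : Measurable φ) (hK : ∀ x, |φ x| ≤ K * |x|) (μi : Fin n) :
    HasMoments (fun q : inputStudSpace d L n => netOut φ d L q.2.1 q.2.2.1 (q.1 μi))
      (inputStudMeasure d L n) :=
  (HasMoments.sum Finset.univ fun i _ =>
    ((hasMoments_stdGPi i).comp_measurePreserving (measurePreserving_readout d L n)).mul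
      (hasMoments_feat d L n hφ hK μi L i)).div_const _

/-- The linear readout `v⊤X^{(L-1)}/√d_{L-1}` of the last hidden layer but one. -/
def linOut (φ : ℝ → ℝ) (d : ℕ → ℕ) (L : ℕ) (W : Wspace d L) (v : Fin (d (L - 1)) → ℝ)
    (x0 : Fin (d 0) → ℝ) : ℝ :=
  (∑ j, v j * feat φ d (extW W) x0 (L - 1) j) / Real.sqrt (d (L - 1) : ℝ)

lemma hasMoments_linOut (hφ : Measurable φ) (hK : ∀ x, |φ x| ≤ K * |x|) (μi : Fin n) :
    HasMoments (fun q : inputStudSpace d L n => linOut φ d L q.2.1 q.2.2.2.1 (q.1 μi))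
      (inputStudMeasure d L n) :=
  (HasMoments.sum Finset.univ fun j _ =>
    ((hasMoments_stdGPi j).comp_measurePreserving (measurePreserving_linear_readout d L n)).mul
      (hasMoments_feat d L n hφ hK μi (L - 1) j)).div_const _

lemma hasMoments_stI (hφ : Measurable φ) (hK : ∀ x, |φ x| ≤ K * |x|) (t : ℝ) (μi : Fin n) :
    HasMoments (fun q : inputStudSpace d L n => stI φ d L n t q.1 q.2 μi)
      (inputStudMeasure d L n) :=
  (((hasMoments_netOut d L n hφ hK μi).const_mul _).add
    ((hasMoments_linOut d L n hφ hK μi).const_mul _)).add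
    (((hasMoments_stdGPi μi).comp_measurePreserving
      (measurePreserving_student_noise d L n)).const_mul _)

lemma deriv_stI {t : ℝ} (ht0 : 0 < t) (ht1 : t < 1) (X : Fin n → Fin (d 0) → ℝ)
    (τ : studSpace d L n) (μi : Fin n) :
    deriv (fun t' => stI φ d L n t' X τ μi) t =
      -1 / (2 * Real.sqrt (1 - t)) * netOut φ d L τ.1 τ.2.1 (X μi) +
        1 / (2 * Real.sqrt t) * rhoC φ L * linOut φ d L τ.1 τ.2.2.1 (X μi) +
        1 / (2 * Real.sqrt t) * Real.sqrt (epsC φ L) * τ.2.2.2 μi := by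
  have h1 : HasDerivAt (fun t' : ℝ => Real.sqrt (1 - t')) (-1 / (2 * Real.sqrt (1 - t))) t :=
    ((hasDerivAt_id t).const_sub 1).sqrt (by simpa using (sub_pos.2 ht1).ne')
  have h2 : HasDerivAt (fun t' : ℝ => Real.sqrt t') (1 / (2 * Real.sqrt t)) t :=
    Real.hasDerivAt_sqrt ht0.ne'
  have h := ((h1.mul_const (netOut φ d L τ.1 τ.2.1 (X μi))).add
    ((h2.mul_const (rhoC φ L)).mul_const (linOut φ d L τ.1 τ.2.2.1 (X μi)))).add
    ((h2.mul_const (Real.sqrt (epsC φ L))).mul_const (τ.2.2.2 μi))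
  refine (h.congr_of_eventuallyEq ?_).deriv
  filter_upwards [lt_mem_nhds ht0] with t' ht'
  simp only [stI, interpSig, linOut, Real.sqrt_mul ht'.le, Pi.add_apply]

lemma hasMoments_deriv_stI (hφ : Measurable φ) (hK : ∀ x, |φ x| ≤ K * |x|) {t : ℝ}
    (ht0 : 0 < t) (ht1 : t < 1) (μi : Fin n) :
    HasMoments (fun q : inputStudSpace d L n => deriv (fun t' => stI φ d L n t' q.1 q.2 μi) t)
      (inputStudMeasure d L n) := by
  simp_rw [deriv_stI d L n ht0 ht1]
  exact (((hasMoments_netOut d L n hφ hK μi).const_mul _).add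
    ((hasMoments_linOut d L n hφ hK μi).const_mul _)).add
    (((hasMoments_stdGPi μi).comp_measurePreserving
      (measurePreserving_student_noise d L n)).const_mul _)

end Network

lemma abs_le_mul_abs_of_odd {φ : ℝ → ℝ} {K : ℝ} (hφ : Differentiable ℝ φ)
    (hodd : ∀ x, φ (-x) = -φ x) (hK : ∀ x, |deriv φ x| ≤ K) (x : ℝ) : |φ x| ≤ K * |x| := by
  have h0 : φ 0 = 0 := by
    have h := hodd 0
    rw [neg_zero] at h
    linarith
  have h := convex_univ.norm_image_sub_le_of_norm_deriv_le (fun y _ => hφ y)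
    (fun y _ => hK y) (Set.mem_univ 0) (Set.mem_univ x)
  simpa [h0] using h

/-- **Lemma E.1 (Vanishing of the annealed term).** For every `t ∈ (0,1)`, the quantity
`B = (1/n) E ⟨ Σ_μ u′_{Y_{tμ}}(s_{tμ}) ds_{tμ}/dt ⟩_t` vanishes identically
(here `ρ = 1`, `ε = 0`). -/
theorem annealed_term_vanishes
    (L p : ℕ) (hL : 1 ≤ L)
    (PA : Measure (Fin p → ℝ)) [IsProbabilityMeasure PA]
    (Δ : ℝ) (hΔ : 0 < Δ)
    (φ : ℝ → ℝ) (f : ℝ → (Fin p → ℝ) → ℝ)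
    (hφC2 : ContDiff ℝ 2 φ) (hφodd : ∀ x, φ (-x) = -φ x)
    (hφbd : ∃ K, ∀ x, |deriv φ x| ≤ K ∧ |deriv (deriv φ) x| ≤ K)
    (hfC2 : ∀ A, ContDiff ℝ 2 (fun x => f x A))
    (hfodd : ∀ x A, f (-x) A = -f x A)
    (hfbd : ∃ K, ∀ x A, |deriv (fun x' => f x' A) x| ≤ K ∧
      |deriv (deriv (fun x' => f x' A)) x| ≤ K)
    (hfmeas : Measurable (Function.uncurry f))
    (d : ℕ → ℕ) (hd : ∀ ℓ ≤ L, 1 ≤ d ℓ) (n : ℕ) (hn : 1 ≤ n)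
    (t : ℝ) (ht0 : 0 < t) (ht1 : t < 1) :
    (1 / (n : ℝ)) *
      ∫ ω, (∫ τ,
            (∑ μi, uD1 PA Δ f (YtI φ f d L n Δ t ω μi) (stI φ d L n t ω.1.1 τ μi) *
              deriv (fun t' => stI φ d L n t' ω.1.1 τ μi) t) *
            ∏ μi, Pout PA Δ f (YtI φ f d L n Δ t ω μi) (stI φ d L n t ω.1.1 τ μi)
          ∂(studMeasure d L n)) / ZtI L p PA Δ φ f d n t ω
        ∂(interpMeasure d L p n PA) = 0 := by
  obtain ⟨Kφ, hKφ⟩ := hφbd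
  obtain ⟨Kf, hKf⟩ := hfbd
  have hφd : Differentiable ℝ φ := hφC2.differentiable two_ne_zero
  have hφm : Measurable φ := hφd.continuous.measurable
  have hφK := abs_le_mul_abs_of_odd hφd hφodd fun x => (hKφ x).1
  have hf : ChannelRegular f Kf :=
    ⟨hfmeas, fun A => (hfC2 A).differentiable two_ne_zero, fun x A => (hKf x A).1⟩
  set s : inputStudSpace d L n → Fin n → ℝ := fun q μi => stI φ d L n t q.1 q.2 μi
  set c : inputStudSpace d L n → Fin n → ℝ :=
    fun q μi => deriv (fun t' => stI φ d L n t' q.1 q.2 μi) t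
  have hs : Measurable s :=
    measurable_pi_lambda _ fun μi => (hasMoments_stI d L n hφm hφK t μi).measurable
  have hc : ∀ μi, Integrable (fun q => c q μi) ((inputMeasure d n).prod (studMeasure d L n)) :=
    fun μi => (hasMoments_deriv_stI d L n hφm hφK ht0 ht1 μi).integrable
  have hT := measurePreserving_input_response (PA := PA) hf hΔ d L n t hs
  have hH := (((hf.integrable_weightedScore_comm (PA := PA) hΔ (inputMeasure d n)
    (studMeasure d L n) hs hc).integral_prod_left.aestronglyMeasurable).div₀
    (hf.measurable_evidence (PA := PA) (Δ := Δ) (studMeasure d L n)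
      hs).aestronglyMeasurable).mono_ac (withDensity_absolutelyContinuous
        ((inputMeasure d n).prod volume) fun z => ENNReal.ofReal
          (evidence PA Δ f (studMeasure d L n) s z))
  have h := hf.integral_posterior_score (PA := PA) hΔ (inputMeasure d n) (studMeasure d L n) hs hc
  rw [← hT.map_eq] at h hH
  exact mul_eq_zero_of_right _ ((integral_map hT.aemeasurable hH).symm.trans h)

end
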